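/- The invariant algebra A^G is commutative if and only if the G-action on L is multiplicity-free, i.e. dim_ℂ Hom_G(V, L) ≤ 1 for every finite-dimensional irreducible complex G-representation V. (Abstract form of Proposition 2.5 on multiplicity-free actions and invariant differential operators.) -/

import Mathlib

/-- Conjugation action of a group element on endomorphisms of `L`:
`g · T := ρ(g) ∘ T ∘ ρ(g)⁻¹`. -/
def conjEnd {G L : Type*} [Group G] [AddCommGroup L] [Module ℂ L]
    (ρ : Representation ℂ G L) (g : G) :
    Module.End ℂ L →ₗ[ℂ] Module.End ℂ L where
  toFun T := ρ g ∘ₗ T ∘ₗ ρ g⁻¹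
  map_add' T S := by ext v; simp
  map_smul' c T := by ext v; simp

/-- The space `Hom_G(V, L)` of `G`-equivariant linear maps `V →ₗ[ℂ] L`. -/
def homG {G L V : Type*} [Group G] [AddCommGroup L] [Module ℂ L]
    [AddCommGroup V] [Module ℂ V]
    (ρ : Representation ℂ G L) (π : Representation ℂ G V) :
    Submodule ℂ (V →ₗ[ℂ] L) where
  carrier := {T | ∀ g : G, T ∘ₗ π g = ρ g ∘ₗ T}
  add_mem' := by
    intro T S hT hS g
    rw [LinearMap.add_comp, LinearMap.comp_add, hT g, hS g]
  zero_mem' := by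
    intro g
    rw [LinearMap.zero_comp, LinearMap.comp_zero]
  smul_mem' := by
    intro c T hT g
    rw [LinearMap.smul_comp, LinearMap.comp_smul, hT g]

open Polynomial in
theorem aux_spectrum_nonempty {M : Type} [AddCommGroup M] [Module ℂ M] [Nontrivial M]
    (hM : Module.rank ℂ M ≤ Cardinal.aleph0) (f : Module.End ℂ M) :
    (spectrum ℂ f).Nonempty := by
  classical
  by_contra hne
  rw [Set.not_nonempty_iff_eq_empty] at hne
  have hunit : ∀ c : ℂ, IsUnit (f - algebraMap ℂ (Module.End ℂ M) c) := by
    intro c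
    have : c ∉ spectrum ℂ f := by rw [hne]; exact Set.notMem_empty c
    rw [spectrum.notMem_iff] at this
    rw [← neg_sub]
    exact this.neg
  have hpoly : ∀ p : ℂ[X], p ≠ 0 → IsUnit (aeval f p) := by
    intro p hp
    by_cases hd : 0 < p.degree
    · have h := spectrum.map_polynomial_aeval_of_degree_pos f p hd
      rw [hne, Set.image_empty] at h
      rw [← spectrum.zero_notMem_iff ℂ, h]
      exact Set.notMem_empty _
    · have h := eq_C_of_degree_le_zero (not_lt.mp hd)
      rw [h, aeval_C]
      refine IsUnit.map _ (isUnit_iff_ne_zero.mpr ?_)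
      intro h0
      rw [h0, C_0] at h
      exact hp h
  obtain ⟨m, hm⟩ := exists_ne (0 : M)
  have hex : ∀ c : ℂ, ∃ u : M, aeval f (X - C c) u = m := by
    intro c
    have := ((Module.End.isUnit_iff _).mp (hpoly (X - C c) (X_sub_C_ne_zero c))).2 m
    exact this
  choose u hu using hex
  have hli : LinearIndependent ℂ u := by
    refine linearIndependent_iff'.2 fun s a ha i hi ↦ ?_
    let p : ℂ[X] := ∑ i ∈ s, C (a i) * ∏ j ∈ s.erase i, (X - C j)
    have hpm : aeval f p m = 0 := by
      have h1 : aeval f (∏ j ∈ s, (X - C j)) (∑ i ∈ s, a i • u i) = aeval f p m := by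
        simp only [p, map_sum, LinearMap.sum_apply, map_smul]
        refine Finset.sum_congr rfl fun i hi ↦ ?_
        rw [← s.prod_erase_mul _ hi, map_mul, Module.End.mul_apply, hu, map_mul, aeval_C,
          Module.End.mul_apply, Module.algebraMap_end_apply]
      rw [← h1, ha, map_zero]
    have hp0 : p = 0 := by
      by_contra hp
      have := ((Module.End.isUnit_iff _).mp (hpoly p hp)).1
      exact hm (this (by rw [hpm, map_zero]))
    have hev := congrArg (eval i) hp0
    have h2 : ∀ j ∈ s.erase i, a j * (∏ x ∈ s.erase j, (i - x)) = 0 := fun j hj ↦ by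
      have := Finset.mem_erase_of_ne_of_mem (Finset.ne_of_mem_erase hj).symm hi
      rw [Finset.prod_eq_zero this (sub_self i), mul_zero]
    simp only [p, eval_finsetSum, eval_mul, eval_C, eval_prod, eval_sub, eval_X, eval_zero] at hev
    rw [← s.sum_erase_add _ hi, Finset.sum_eq_zero h2, zero_add] at hev
    exact (mul_eq_zero.mp hev).resolve_right (Finset.prod_ne_zero_iff.2 fun j hj ↦
      sub_ne_zero.2 (Finset.ne_of_mem_erase hj).symm)
  have h := hli.cardinal_le_rank
  rw [Cardinal.mk_complex] at h
  exact absurd (h.trans hM) (not_le.mpr Cardinal.aleph0_lt_continuum)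

theorem aux_not_bijective {M : Type} [AddCommGroup M] [Module ℂ M] [Nontrivial M]
    (hM : Module.rank ℂ M ≤ Cardinal.aleph0) (f : Module.End ℂ M) :
    ∃ c : ℂ, ¬ Function.Bijective (f - algebraMap ℂ (Module.End ℂ M) c) := by
  obtain ⟨c, hc⟩ := aux_spectrum_nonempty hM f
  rw [spectrum.mem_iff, ← neg_sub, IsUnit.neg_iff, Module.End.isUnit_iff] at hc
  exact ⟨c, hc⟩

theorem aux_dixmier {R M : Type} [Ring R] [Algebra ℂ R] [AddCommGroup M] [Module ℂ M]
    [Module R M] [IsScalarTower ℂ R M] [IsSimpleModule R M]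
    (hM : Module.rank ℂ M ≤ Cardinal.aleph0) (f : Module.End R M) :
    ∃ c : ℂ, ∀ x, f x = c • x := by
  have : Nontrivial M := IsSimpleModule.nontrivial R M
  obtain ⟨c, hc⟩ := aux_spectrum_nonempty hM (f.restrictScalars ℂ)
  refine ⟨c, ?_⟩
  let d : Module.End R M := f - algebraMap ℂ (Module.End R M) c
  rcases LinearMap.bijective_or_eq_zero d with hb | h0
  · exfalso
    rw [spectrum.mem_iff, ← neg_sub, IsUnit.neg_iff, Module.End.isUnit_iff] at hc
    apply hc
    exact hb
  · intro x
    have := congrArg (fun e => e x) h0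
    simpa [d, sub_eq_zero] using this

theorem aux_density {L V : Type} [AddCommGroup L] [Module ℂ L] [AddCommGroup V] [Module ℂ V]
    [FiniteDimensional ℂ V] [Nontrivial L]
    (hM : Module.rank ℂ L ≤ Cardinal.aleph0)
    (A : Subalgebra ℂ (Module.End ℂ L))
    (hAirr : ∀ p : Submodule ℂ L, (∀ T ∈ A, ∀ x ∈ p, T x ∈ p) → p = ⊥ ∨ p = ⊤)
    (T S : V →ₗ[ℂ] L) (hT : Function.Injective T) : ∃ a ∈ A, a ∘ₗ T = S := by
  classical
  have hsimp : IsSimpleModule A L := by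
    rw [isSimpleModule_iff]
    refine { eq_bot_or_eq_top := fun p => ?_ }
    rcases hAirr (p.restrictScalars ℂ) (fun T hT x hx => p.smul_mem ⟨T, hT⟩ hx) with h | h
    · left; simpa using h
    · right; simpa using h
  obtain ⟨r, hr⟩ := LinearMap.exists_leftInverse_of_injective T (LinearMap.ker_eq_bot.mpr hT)
  let F : Module.End (Module.End A L) L :=
    { toFun := S ∘ₗ r
      map_add' := map_add _
      map_smul' := by
        intro f x
        obtain ⟨c, hc⟩ := aux_dixmier hM f
        simp only [Module.End.smul_def, RingHom.id_apply, hc, map_smul] }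
  let b := Module.finBasis ℂ V
  obtain ⟨a, ha⟩ := jacobson_density (R := A) F (Finset.univ.image fun i => T (b i))
  refine ⟨a.1, a.2, b.ext fun i => ?_⟩
  have h := ha (T (b i)) (Finset.mem_image_of_mem _ (Finset.mem_univ i))
  have h2 : F (T (b i)) = S (b i) := congrArg S (congrArg (fun e => e (b i)) hr)
  rw [h2] at h
  exact h.symm

theorem conjEnd_eq_iff {G L : Type*} [Group G] [AddCommGroup L] [Module ℂ L]
    (ρ : Representation ℂ G L) (D : Module.End ℂ L) :
    (∀ g : G, conjEnd ρ g D = D) ↔ ∀ g x, D (ρ g x) = ρ g (D x) := by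
  constructor
  · intro h g x
    conv_lhs => rw [← h g]
    simp [conjEnd]
  · intro h g
    ext x
    simp [conjEnd, h]

/-- lifting invariants -/
theorem aux_lift {G : Type*} {L V : Type} [Group G] [AddCommGroup L] [Module ℂ L]
    [AddCommGroup V] [Module ℂ V]
    (ρ : Representation ℂ G L) (π : Representation ℂ G V)
    (A : Subalgebra ℂ (Module.End ℂ L))
    (hAG : ∀ g : G, ∀ T ∈ A, conjEnd ρ g T ∈ A)
    (hAcompred : ∀ p : Submodule ℂ (Module.End ℂ L),
      p ≤ Subalgebra.toSubmodule A → (∀ g : G, ∀ S ∈ p, conjEnd ρ g S ∈ p) →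
      ∃ q : Submodule ℂ (Module.End ℂ L), q ≤ Subalgebra.toSubmodule A ∧
        (∀ g : G, ∀ S ∈ q, conjEnd ρ g S ∈ q) ∧
        p ⊓ q = ⊥ ∧ p ⊔ q = Subalgebra.toSubmodule A)
    (T S : V →ₗ[ℂ] L) (hT : T ∈ homG ρ π) (hS : S ∈ homG ρ π)
    (a : Module.End ℂ L) (haA : a ∈ A) (ha : a ∘ₗ T = S) :
    ∃ D ∈ A, (∀ g : G, conjEnd ρ g D = D) ∧ D ∘ₗ T = S := by
  have hT' : ∀ g x, T (π g x) = ρ g (T x) := fun g x => congrArg (fun e => e x) (hT g)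
  have hS' : ∀ g x, S (π g x) = ρ g (S x) := fun g x => congrArg (fun e => e x) (hS g)
  have key : ∀ (E : Module.End ℂ L) g x, conjEnd ρ g E (T x) = ρ g (E (T (π g⁻¹ x))) := by
    intro E g x
    simp [conjEnd, hT']
  let Φ : Module.End ℂ L →ₗ[ℂ] (V →ₗ[ℂ] L) := LinearMap.lcomp ℂ L T
  have hΦ : ∀ E x, Φ E x = E (T x) := fun E x => rfl
  obtain ⟨q, hqA, hqG, hinf, hsup⟩ := hAcompred (Subalgebra.toSubmodule A ⊓ LinearMap.ker Φ)
    inf_le_left (by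
      rintro g E ⟨hE1, hE2⟩
      refine ⟨hAG g E hE1, ?_⟩
      ext x
      have := congrArg (fun e => e (π g⁻¹ x)) hE2
      simp only [hΦ] at this
      rw [hΦ, key, this]
      simp)
  have haS : a ∈ Subalgebra.toSubmodule A := haA
  rw [← hsup] at haS
  obtain ⟨k, hk, D, hD, hkD⟩ := Submodule.mem_sup.mp haS
  have hDT : ∀ x, D (T x) = S x := by
    intro x
    have h1 : k (T x) = 0 := congrArg (fun e => e x) hk.2
    rw [← ha, ← hkD]
    simp [h1]
  refine ⟨D, hqA hD, fun g => ?_, LinearMap.ext hDT⟩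
  have hmem : conjEnd ρ g D - D ∈ (Subalgebra.toSubmodule A ⊓ LinearMap.ker Φ) ⊓ q := by
    have hq := q.sub_mem (hqG g D hD) hD
    refine ⟨⟨hqA hq, ?_⟩, hq⟩
    ext x
    rw [hΦ, LinearMap.sub_apply, key, hDT, hDT, ← hS']
    simp
  rw [hinf] at hmem
  exact sub_eq_zero.mp hmem

theorem aux_forward {G : Type*} {L V : Type} [Group G] [AddCommGroup L] [Module ℂ L]
    [AddCommGroup V] [Module ℂ V] [FiniteDimensional ℂ V]
    (ρ : Representation ℂ G L) (π : Representation ℂ G V)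
    (hM : Module.rank ℂ L ≤ Cardinal.aleph0)
    (A : Subalgebra ℂ (Module.End ℂ L))
    (hcomm : ∀ D ∈ A, (∀ g : G, conjEnd ρ g D = D) →
      ∀ E ∈ A, (∀ g : G, conjEnd ρ g E = E) → D * E = E * D)
    (htrans : ∀ T ∈ homG ρ π, T ≠ 0 → ∀ S ∈ homG ρ π,
      ∃ D ∈ A, (∀ g : G, conjEnd ρ g D = D) ∧ D ∘ₗ T = S) :
    Module.rank ℂ ↥(homG ρ π) ≤ 1 := by
  have hrk : Module.rank ℂ ↥(homG ρ π) ≤ Cardinal.aleph0 := by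
    refine (Submodule.rank_le _).trans ?_
    rw [Module.rank_linearMap]
    simp only [Cardinal.lift_id]
    exact (mul_le_mul' (Module.rank_lt_aleph0 ℂ V).le hM).trans Cardinal.aleph0_mul_aleph0.le
  rw [rank_le_one_iff]
  by_cases h0 : ∃ T : homG ρ π, T ≠ 0
  swap
  · push Not at h0
    exact ⟨0, fun v => ⟨0, by rw [h0 v, smul_zero]⟩⟩
  obtain ⟨T, hT⟩ := h0
  have : Nontrivial (homG ρ π) := ⟨T, 0, hT⟩
  refine ⟨T, fun S => ?_⟩
  obtain ⟨D, hDA, hDG, hDT⟩ := htrans T.1 T.2 (by simpa using hT) S.1 S.2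
  let act : (D : Module.End ℂ L) → (∀ g : G, conjEnd ρ g D = D) → Module.End ℂ (homG ρ π) :=
    fun D hD => (LinearMap.compRight ℂ D : (V →ₗ[ℂ] L) →ₗ[ℂ] (V →ₗ[ℂ] L)).restrict
      (p := homG ρ π) (q := homG ρ π) (by
        intro T hT g
        rw [conjEnd_eq_iff] at hD
        ext x
        have := congrArg (fun e => e x) (hT g)
        simp only [LinearMap.comp_apply] at this
        simp [this, hD])
  have hact : ∀ D hD T x, (act D hD T).1 x = D (T.1 x) := fun _ _ _ _ => rfl
  obtain ⟨c, hc⟩ := aux_not_bijective hrk (act D hDG)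
  set φ := act D hDG - algebraMap ℂ (Module.End ℂ (homG ρ π)) c with hφ
  have htr : ∀ T : homG ρ π, T ≠ 0 → ∀ S, ∃ E : Module.End ℂ (homG ρ π), E T = S ∧
      ∀ X, φ (E X) = E (φ X) := by
    intro T hT S
    obtain ⟨E, hEA, hEG, hET⟩ := htrans T.1 T.2 (by simpa using hT) S.1 S.2
    refine ⟨act E hEG, Subtype.ext hET, fun X => ?_⟩
    have h1 : act D hDG (act E hEG X) = act E hEG (act D hDG X) := by
      apply Subtype.ext
      ext x
      simp only [hact]
      exact congrArg (fun e => e (X.1 x)) (hcomm D hDA hDG E hEA hEG)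
    simp only [hφ, LinearMap.sub_apply, Module.algebraMap_end_apply, map_sub, map_smul, h1]
  have hzero : ∀ X, φ X = 0 := by
    by_contra hne
    push Not at hne
    obtain ⟨X, hX⟩ := hne
    apply hc
    constructor
    · rw [injective_iff_map_eq_zero]
      intro Y hY
      by_contra hY0
      obtain ⟨E, hE, hEφ⟩ := htr Y hY0 X
      apply hX
      rw [← hE, hEφ, hY, map_zero]
    · intro Y
      obtain ⟨E, hE, hEφ⟩ := htr (φ X) hX Y
      exact ⟨E X, by rw [hEφ, hE]⟩
  refine ⟨c, ?_⟩
  have h := hzero T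
  simp only [hφ, LinearMap.sub_apply, Module.algebraMap_end_apply, sub_eq_zero] at h
  rw [← h]
  exact Subtype.ext hDT

/-- A nonzero finite-dimensional invariant subspace contains an irreducible one. -/
theorem aux_exists_irred {G : Type*} {L : Type} [Group G] [AddCommGroup L] [Module ℂ L]
    (ρ : Representation ℂ G L) (n : ℕ) : ∀ (Y : Submodule ℂ L) [FiniteDimensional ℂ Y],
    Module.finrank ℂ Y = n → Y ≠ ⊥ → (∀ g : G, ∀ y ∈ Y, ρ g y ∈ Y) →
    ∃ W ≤ Y, W ≠ ⊥ ∧ (∀ g : G, ∀ y ∈ W, ρ g y ∈ W) ∧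
      ∀ p ≤ W, (∀ g : G, ∀ y ∈ p, ρ g y ∈ p) → p = ⊥ ∨ p = W := by
  induction n using Nat.strong_induction_on with
  | _ n ih =>
    intro Y _ hn hY hG
    by_cases h : ∀ p ≤ Y, (∀ g : G, ∀ y ∈ p, ρ g y ∈ p) → p = ⊥ ∨ p = Y
    · exact ⟨Y, le_rfl, hY, hG, h⟩
    · push Not at h
      obtain ⟨p, hpY, hpG, hp0, hp1⟩ := h
      have : FiniteDimensional ℂ p := Submodule.finiteDimensional_of_le hpY
      obtain ⟨W, hW, h2⟩ := ih _ (hn ▸ Submodule.finrank_lt_finrank_of_lt (lt_of_le_of_ne hpY hp1))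
        p rfl hp0 hpG
      exact ⟨W, hW.trans hpY, h2⟩

theorem aux_backward {G : Type*} {L : Type} [Group G] [AddCommGroup L] [Module ℂ L]
    (ρ : Representation ℂ G L)
    (hlocfin : ∀ v : L, ∃ Y : Submodule ℂ L,
      (∀ g : G, ∀ y ∈ Y, ρ g y ∈ Y) ∧ FiniteDimensional ℂ Y ∧ v ∈ Y)
    (hcompred : ∀ p : Submodule ℂ L, (∀ g : G, ∀ y ∈ p, ρ g y ∈ p) →
      ∃ q : Submodule ℂ L, (∀ g : G, ∀ y ∈ q, ρ g y ∈ q) ∧ IsCompl p q)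
    (hmf : ∀ (V : Type) [AddCommGroup V] [Module ℂ V] [FiniteDimensional ℂ V],
      ∀ π : Representation ℂ G V,
        (∀ p : Submodule ℂ V, (∀ g : G, ∀ v ∈ p, π g v ∈ p) → p = ⊥ ∨ p = ⊤) →
        Module.rank ℂ ↥(homG ρ π) ≤ 1)
    (D E : Module.End ℂ L) (hD : ∀ g : G, conjEnd ρ g D = D) (hE : ∀ g : G, conjEnd ρ g E = E) :
    D * E = E * D := by
  rw [conjEnd_eq_iff] at hD hE
  obtain ⟨q, hqG, hq⟩ := hcompred (LinearMap.ker (D * E - E * D)) (by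
    intro g y hy
    rw [LinearMap.mem_ker] at hy ⊢
    have : (D * E - E * D) (ρ g y) = ρ g ((D * E - E * D) y) := by
      simp [hD, hE]
    rw [this, hy, map_zero])
  have hq0 : q = ⊥ := by
    by_contra hne
    obtain ⟨v, hvq, hv0⟩ := Submodule.exists_mem_ne_zero_of_ne_bot hne
    obtain ⟨Y, hYG, hYf, hvY⟩ := hlocfin v
    have : FiniteDimensional ℂ ↥(Y ⊓ q) := Submodule.finiteDimensional_of_le inf_le_left
    obtain ⟨W, hW, hW0, hWG, hWirr⟩ := aux_exists_irred ρ _ (Y ⊓ q) rfl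
      (fun h => hv0 (by
        have : v ∈ Y ⊓ q := ⟨hvY, hvq⟩
        rw [h] at this
        exact this))
      (fun g y hy => ⟨hYG g y hy.1, hqG g y hy.2⟩)
    have : FiniteDimensional ℂ W := Submodule.finiteDimensional_of_le hW
    let π : Representation ℂ G W :=
      { toFun := fun g => (ρ g).restrict (hWG g)
        map_one' := by ext x; simp
        map_mul' := by intro g h; ext x; simp }
    have hπ : ∀ g x, ((π g x : W) : L) = ρ g x := fun _ _ => rfl
    have hrk := hmf W π (by
      intro p hp
      rcases hWirr (p.map W.subtype) (Submodule.map_subtype_le W p) (by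
        rintro g _ ⟨x, hx, rfl⟩
        exact ⟨π g x, hp g x hx, rfl⟩) with h | h
      · left
        exact Submodule.map_injective_of_injective W.injective_subtype (by rw [h, Submodule.map_bot])
      · right
        apply Submodule.map_injective_of_injective W.injective_subtype
        rw [h, Submodule.map_subtype_top])
    rw [rank_le_one_iff] at hrk
    obtain ⟨T0, hT0⟩ := hrk
    have hsc : ∀ D : Module.End ℂ L, (∀ g x, D (ρ g x) = ρ g (D x)) →
        ∃ c : ℂ, ∀ x ∈ W, D x = c • x := by
      intro D hD
      let ι : homG ρ π := ⟨W.subtype, fun g => rfl⟩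
      let Dι : homG ρ π := ⟨D ∘ₗ W.subtype, fun g => by
        ext x
        exact hD g x⟩
      obtain ⟨r, hr⟩ := hT0 ι
      obtain ⟨s, hs⟩ := hT0 Dι
      have hr' : ∀ x : W, r • T0.1 x = x := fun x => congrArg (fun e => e.1 x) hr
      have hs' : ∀ x : W, s • T0.1 x = D x := fun x => congrArg (fun e => e.1 x) hs
      have hr0 : r ≠ 0 := by
        rintro rfl
        apply hW0
        rw [eq_bot_iff]
        intro x hx
        have := hr' ⟨x, hx⟩
        rw [zero_smul] at this
        exact this.symm
      refine ⟨s * r⁻¹, fun x hx => ?_⟩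
      rw [← hs' ⟨x, hx⟩]
      conv_rhs => rw [show x = r • T0.1 ⟨x, hx⟩ from (hr' ⟨x, hx⟩).symm]
      rw [smul_smul, inv_mul_cancel_right₀ hr0]
    obtain ⟨c, hc⟩ := hsc D hD
    obtain ⟨d, hd⟩ := hsc E hE
    apply hW0
    rw [eq_bot_iff]
    intro x hx
    have hxk : x ∈ LinearMap.ker (D * E - E * D) := by
      rw [LinearMap.mem_ker]
      simp [hc x hx, hd x hx, smul_smul, mul_comm]
    have : x ∈ LinearMap.ker (D * E - E * D) ⊓ q := ⟨hxk, (hW hx).2⟩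
    rw [hq.inf_eq_bot] at this
    exact this
  have h := hq.sup_eq_top
  rw [hq0, sup_bot_eq, LinearMap.ker_eq_top, sub_eq_zero] at h
  exact h

/-- **Multiplicity-free actions and commutativity of the invariant algebra
(abstract form of Proposition 2.5).**
Under the standing hypotheses on `G`, `L` and `A`, the invariant algebra
`A^G` is commutative if and only if the `G`-action on `L` is
multiplicity-free, i.e. `dim_ℂ Hom_G(V, L) ≤ 1` for every finite-dimensional
irreducible complex `G`-representation `V`. -/
theorem invariant_algebra_commutative_iff_multiplicity_free
    {G : Type*} {L : Type} [Group G] [AddCommGroup L] [Module ℂ L]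
    (ρ : Representation ℂ G L)
    -- `L` has countable dimension
    (hcount : ∃ s : Set L, s.Countable ∧ Submodule.span ℂ s = ⊤)
    -- the `G`-action on `L` is locally finite
    (hlocfin : ∀ v : L, ∃ Y : Submodule ℂ L,
      (∀ g : G, ∀ y ∈ Y, ρ g y ∈ Y) ∧ FiniteDimensional ℂ Y ∧ v ∈ Y)
    -- the `G`-action on `L` is completely reducible
    (hcompred : ∀ p : Submodule ℂ L, (∀ g : G, ∀ y ∈ p, ρ g y ∈ p) →
      ∃ q : Submodule ℂ L, (∀ g : G, ∀ y ∈ q, ρ g y ∈ q) ∧ IsCompl p q)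
    (A : Subalgebra ℂ (Module.End ℂ L))
    -- `A` acts irreducibly on `L`
    (hAirr : ∀ p : Submodule ℂ L, (∀ T ∈ A, ∀ x ∈ p, T x ∈ p) → p = ⊥ ∨ p = ⊤)
    -- `A` is invariant under the conjugation `G`-action
    (hAG : ∀ g : G, ∀ T ∈ A, conjEnd ρ g T ∈ A)
    -- the `G`-action on `A` is locally finite
    (hAlocfin : ∀ T ∈ A, ∃ E : Submodule ℂ (Module.End ℂ L),
      E ≤ Subalgebra.toSubmodule A ∧ (∀ g : G, ∀ S ∈ E, conjEnd ρ g S ∈ E) ∧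
      FiniteDimensional ℂ E ∧ T ∈ E)
    -- the `G`-action on `A` is completely reducible
    (hAcompred : ∀ p : Submodule ℂ (Module.End ℂ L),
      p ≤ Subalgebra.toSubmodule A → (∀ g : G, ∀ S ∈ p, conjEnd ρ g S ∈ p) →
      ∃ q : Submodule ℂ (Module.End ℂ L), q ≤ Subalgebra.toSubmodule A ∧
        (∀ g : G, ∀ S ∈ q, conjEnd ρ g S ∈ q) ∧
        p ⊓ q = ⊥ ∧ p ⊔ q = Subalgebra.toSubmodule A) :
    -- `A^G` is commutative ↔ the `G`-action on `L` is multiplicity-free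
    (∀ D ∈ A, (∀ g : G, conjEnd ρ g D = D) →
      ∀ E ∈ A, (∀ g : G, conjEnd ρ g E = E) → D * E = E * D) ↔
    (∀ (V : Type) [AddCommGroup V] [Module ℂ V] [FiniteDimensional ℂ V],
      ∀ π : Representation ℂ G V,
        (∀ p : Submodule ℂ V, (∀ g : G, ∀ v ∈ p, π g v ∈ p) → p = ⊥ ∨ p = ⊤) →
        Module.rank ℂ ↥(homG ρ π) ≤ 1) := by
  have hM : Module.rank ℂ L ≤ Cardinal.aleph0 := by
    obtain ⟨s, hs, hspan⟩ := hcount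
    rw [← rank_top, ← hspan]
    exact (rank_span_le s).trans hs.le_aleph0
  constructor
  · intro hcomm V _ _ _ π hirr
    refine aux_forward ρ π hM A hcomm fun T hT hT0 S hS => ?_
    have hinj : Function.Injective T := by
      rw [← LinearMap.ker_eq_bot]
      refine (hirr (LinearMap.ker T) fun g v hv => ?_).resolve_right fun h =>
        hT0 (LinearMap.ker_eq_top.mp h)
      rw [LinearMap.mem_ker] at hv ⊢
      have h1 : T (π g v) = ρ g (T v) := congrArg (fun e => e v) (hT g)
      rw [h1, hv, map_zero]
    have hL : Nontrivial L := by
      by_contra hn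
      rw [not_nontrivial_iff_subsingleton] at hn
      exact hT0 (LinearMap.ext fun x => Subsingleton.elim _ _)
    obtain ⟨a, haA, ha⟩ := aux_density hM A hAirr T S hinj
    exact aux_lift ρ π A hAG hAcompred T S hT hS a haA ha
  · intro hmf D _ hDG E _ hEG
    exact aux_backward ρ hlocfin hcompred hmf D E hDG hEG
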